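/- Let (A, φ) be a C*-probability space with faithful tracial φ. Let X_1, …, X_n be free self-adjoint elements of A with φ(X_i) = 0 and φ(X_i²) = σ_i², B_n² := ∑_{i=1}^n σ_i² > 0, and suppose L_{S,4n} < 1/64. Then the analytic distribution μ_n of the self-normalized sum U_n := V_n^{−1/2} S_n V_n^{−1/2} (with S_n := ∑_{i=1}^n X_i, V_n² := ∑_{i=1}^n X_i²) satisfies supp μ_n ⊂ ( −2 − max_{i≤n}‖X_i‖/B_n − 57·L_{S,4n}^{1/2} , 2 + max_{i≤n}‖X_i‖/B_n + 57·L_{S,4n}^{1/2} ). -/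

import Mathlib

open MeasureTheory Filter Topology

noncomputable section

/-- Wigner's semicircle law: density `(2π)⁻¹ √(4 - t²)` on `[-2, 2]`. -/
def semicircleLaw : Measure ℝ :=
  volume.withDensity fun t =>
    ENNReal.ofReal (Set.indicator (Set.Icc (-2 : ℝ) 2)
      (fun t => (2 * Real.pi)⁻¹ * Real.sqrt (4 - t ^ 2)) t)

/-- Distribution function of a measure on `ℝ`. -/
def cdf (μ : Measure ℝ) (x : ℝ) : ℝ := (μ (Set.Iic x)).toReal

/-- Kolmogorov distance. -/
def kolDist (μ ν : Measure ℝ) : ℝ := ⨆ x : ℝ, |cdf μ x - cdf ν x|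

/-- Cauchy transform. -/
def cauchyG (μ : Measure ℝ) (z : ℂ) : ℂ := ∫ t, (z - (t : ℂ))⁻¹ ∂μ

/-- Support of a measure on `ℝ`. -/
def msupport (μ : Measure ℝ) : Set ℝ :=
  {x : ℝ | ∀ U : Set ℝ, IsOpen U → x ∈ U → 0 < μ U}

variable {A : Type*}

/-- `φ` is a state: unital and positive. -/
def IsState [Ring A] [StarRing A] [Algebra ℂ A] (φ : A →ₗ[ℂ] ℂ) : Prop :=
  φ 1 = 1 ∧ ∀ x : A, 0 ≤ (φ (star x * x)).re ∧ (φ (star x * x)).im = 0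

/-- `φ` is tracial. -/
def IsTracial [Ring A] [Algebra ℂ A] (φ : A →ₗ[ℂ] ℂ) : Prop :=
  ∀ x y : A, φ (x * y) = φ (y * x)

/-- `φ` is faithful. -/
def IsFaithful [Ring A] [StarRing A] [Algebra ℂ A] (φ : A →ₗ[ℂ] ℂ) : Prop :=
  ∀ x : A, φ (star x * x) = 0 → x = 0

/-- Freeness of a family of unital subalgebras w.r.t. `φ`. -/
def IsFreeFamily [Ring A] [Algebra ℂ A] (φ : A →ₗ[ℂ] ℂ)
    {I : Type*} (S : I → Subalgebra ℂ A) : Prop :=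
  ∀ (k : ℕ) (idx : Fin (k + 1) → I),
    (∀ j : Fin k, idx j.castSucc ≠ idx j.succ) →
    ∀ x : Fin (k + 1) → A, (∀ j, x j ∈ S (idx j)) → (∀ j, φ (x j) = 0) →
      φ (List.ofFn x).prod = 0

/-- Freeness of a family of elements: the generated unital subalgebras are free. -/
def AreFree [Ring A] [Algebra ℂ A] (φ : A →ₗ[ℂ] ℂ) {I : Type*} (X : I → A) : Prop :=
  IsFreeFamily φ fun i => Algebra.adjoin ℂ {X i}

/-- `μ` is the analytic distribution of `x`: a probability measure whose moments are the
`φ`-moments of `x`. -/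
def IsDistribution [Ring A] [Algebra ℂ A] (φ : A →ₗ[ℂ] ℂ) (x : A) (μ : Measure ℝ) : Prop :=
  IsProbabilityMeasure μ ∧ ∀ k : ℕ, φ (x ^ k) = ((∫ t, t ^ k ∂μ : ℝ) : ℂ)

/-- The Lyapunov-type fraction `L_{S,kn} = (∑_{i<n} ‖X i‖ ^ k) / B_n ^ k`. -/
def Lsn [Norm A] (X : ℕ → A) (σ : ℕ → ℝ) (k n : ℕ) : ℝ :=
  (∑ i ∈ Finset.range n, ‖X i‖ ^ k) /
    Real.sqrt (∑ i ∈ Finset.range n, σ i ^ 2) ^ k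

/-- `s` is a standard semicircular element. -/
def IsStdSemicircular [Ring A] [StarRing A] [Algebra ℂ A] (φ : A →ₗ[ℂ] ℂ) (s : A) : Prop :=
  IsSelfAdjoint s ∧ ∀ k : ℕ, φ (s ^ k) = ((∫ t, t ^ k ∂semicircleLaw : ℝ) : ℂ)

end

open scoped InnerProductSpace

/-- **Voiculescu's norm estimate**, Hilbert space form. -/
theorem norm_sum_apply_le_of_pairwise_isOrtho {H : Type*} [NormedAddCommGroup H]
    [InnerProductSpace ℂ H] [CompleteSpace H] {I : Type*} (s : Finset I)
    (E : Option I → Submodule ℂ H) (hE : ∀ o o', o ≠ o' → E o ⟂ E o')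
    (T : I → H →L[ℂ] H) (hT : ∀ i x y, ⟪T i x, y⟫_ℂ = ⟪x, T i y⟫_ℂ)
    (hleft : ∀ i o, o ≠ some i → ∀ x ∈ E o, T i x ∈ E (some i))
    (hstep : ∀ i, ∀ x ∈ E (some i), T i x ∈ ⨆ o, E o)
    (c : I → ℝ) (hc : ∀ i, 0 ≤ c i)
    (hsq : ∀ i o, o ≠ some i → ∀ x ∈ E o, T i (T i x) - (c i : ℂ) • x ∈ E (some i))
    (M : ℝ) (hM : 0 ≤ M) (hTM : ∀ i ∈ s, ‖T i‖ ≤ M) (x : H) (hx : x ∈ ⨆ o, E o) :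
    (∑ i ∈ s, T i x) ∈ (⨆ o, E o) ∧
      ‖∑ i ∈ s, T i x‖ ≤ (M + 2 * √(∑ i ∈ s, c i)) * ‖x‖ := by
  classical
  set P : I → H →L[ℂ] H := fun i => (E (some i)).topologicalClosure.starProjection with hP
  have hP_mem : ∀ i, ∀ x ∈ E (some i), P i x = x := fun i x hx =>
    Submodule.starProjection_eq_self_iff.2 (Submodule.le_topologicalClosure _ hx)
  have hP_zero : ∀ i o, o ≠ some i → ∀ x ∈ E o, P i x = 0 := by
    intro i o ho x hx
    refine (Submodule.starProjection_apply_eq_zero_iff _).2 ?_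
    rw [Submodule.orthogonal_closure]
    exact (hE _ _ ho) hx
  have hP_symm : ∀ i x y, ⟪P i x, y⟫_ℂ = ⟪x, P i y⟫_ℂ := fun i x y =>
    Submodule.inner_starProjection_left_eq_right _ x y
  have hP_norm : ∀ i x, ‖P i x‖ ≤ ‖x‖ := fun i x => Submodule.norm_starProjection_apply_le _ x
  have hQ_norm : ∀ i x, ‖x - P i x‖ ≤ ‖x‖ := by
    intro i x
    rw [← Submodule.starProjection_orthogonal_val]
    exact Submodule.norm_starProjection_apply_le _ x
  have key : ∀ i, ∀ x ∈ ⨆ o, E o, P i x ∈ E (some i) ∧ T i (x - P i x) ∈ E (some i) ∧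
      T i (T i (x - P i x)) - (c i : ℂ) • (x - P i x) ∈ E (some i) := by
    intro i x hx
    induction hx using Submodule.iSup_induction' with
    | mem o x hx =>
      by_cases ho : o = some i
      · subst ho
        simp [hP_mem i x hx, hx]
      · rw [hP_zero i o ho x hx, sub_zero]
        exact ⟨zero_mem _, hleft i o ho x hx, hsq i o ho x hx⟩
    | zero => simp
    | add x y _ _ hx hy =>
      rw [map_add, add_sub_add_comm, map_add, map_add, smul_add, add_sub_add_comm]
      exact ⟨add_mem hx.1 hy.1, add_mem hx.2.1 hy.2.1, add_mem hx.2.2 hy.2.2⟩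
  have hle : ∀ o, E o ≤ ⨆ o, E o := fun o => le_iSup E o
  have hTD : ∀ i, ∀ x ∈ ⨆ o, E o, T i x ∈ ⨆ o, E o := by
    intro i x hx
    obtain ⟨h1, h2, -⟩ := key i x hx
    have := add_mem (hstep i _ h1) (hle _ h2)
    rwa [← map_add, add_sub_cancel] at this
  have hortho : ∀ v : I → H, (∀ i, v i ∈ E (some i)) →
      ‖∑ i ∈ s, v i‖ ^ 2 = ∑ i ∈ s, ‖v i‖ ^ 2 := by
    intro v hv
    have hO : OrthogonalFamily ℂ (fun i => E (some i)) fun i => (E (some i)).subtypeₗᵢ :=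
      OrthogonalFamily.of_pairwise fun i j hij => hE _ _ (by simpa using hij)
    exact hO.norm_sum (fun i => ⟨v i, hv i⟩) s
  have bessel : ∀ x ∈ ⨆ o, E o, ∑ i ∈ s, ‖P i x‖ ^ 2 ≤ ‖x‖ ^ 2 := by
    intro x hx
    have h1 := hortho (fun i => P i x) fun i => (key i x hx).1
    have h2 : RCLike.re ⟪x, ∑ i ∈ s, P i x⟫_ℂ = ∑ i ∈ s, ‖P i x‖ ^ 2 := by
      rw [inner_sum, map_sum]
      refine Finset.sum_congr rfl fun i _ => ?_
      have h : ⟪x, P i x⟫_ℂ = ⟪P i x, P i x⟫_ℂ := by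
        rw [hP_symm, hP_mem i _ (key i x hx).1]
      rw [h, inner_self_eq_norm_sq]
    have h3 := re_inner_le_norm (𝕜 := ℂ) x (∑ i ∈ s, P i x)
    rw [h2, ← h1] at h3
    rw [← h1]
    have : ‖∑ i ∈ s, P i x‖ ≤ ‖x‖ := by
      by_contra! h
      nlinarith [norm_nonneg x]
    gcongr
  set B := √(∑ i ∈ s, c i) with hB
  have hB2 : B ^ 2 = ∑ i ∈ s, c i := Real.sq_sqrt (Finset.sum_nonneg fun i _ => hc i)
  have hB0 : 0 ≤ B := Real.sqrt_nonneg _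
  have hb : ∀ x ∈ ⨆ o, E o, ‖∑ i ∈ s, T i (x - P i x)‖ ≤ B * ‖x‖ := by
    intro x hx
    refine (sq_le_sq₀ (norm_nonneg _) (by positivity)).1 ?_
    rw [hortho _ fun i => (key i x hx).2.1, mul_pow, hB2, Finset.sum_mul]
    refine Finset.sum_le_sum fun i _ => ?_
    obtain ⟨-, h1, h2⟩ := key i x hx
    have h3 : ⟪x - P i x, T i (T i (x - P i x)) - (c i : ℂ) • (x - P i x)⟫_ℂ = 0 := by
      rw [inner_sub_left, hP_symm, hP_mem i _ h2, sub_self]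
    rw [inner_sub_right, inner_smul_right, ← hT, sub_eq_zero] at h3
    have h4 := congrArg Complex.re h3
    rw [inner_self_eq_norm_sq_to_K, inner_self_eq_norm_sq_to_K] at h4
    have h5 : ‖T i (x - P i x)‖ ^ 2 = c i * ‖x - P i x‖ ^ 2 := by
      simpa [← Complex.ofReal_pow, ← Complex.ofReal_mul] using h4
    rw [h5]
    have := hc i
    have := hQ_norm i x
    gcongr
  have ha : ‖∑ i ∈ s, P i (T i (P i x))‖ ≤ M * ‖x‖ := by
    refine (sq_le_sq₀ (norm_nonneg _) (by positivity)).1 ?_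
    rw [hortho _ fun i => (key i _ (hTD i _ (hle _ (key i x hx).1))).1, mul_pow]
    calc ∑ i ∈ s, ‖P i (T i (P i x))‖ ^ 2 ≤ ∑ i ∈ s, M ^ 2 * ‖P i x‖ ^ 2 := by
          refine Finset.sum_le_sum fun i hi => ?_
          rw [← mul_pow]
          gcongr
          exact (hP_norm _ _).trans ((T i).le_of_opNorm_le (hTM i hi) _)
      _ ≤ M ^ 2 * ‖x‖ ^ 2 := by
          rw [← Finset.mul_sum]
          have := bessel x hx
          gcongr
  have hcc : ‖∑ i ∈ s, (T i (P i x) - P i (T i (P i x)))‖ ≤ B * ‖x‖ := by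
    set y := ∑ i ∈ s, (T i (P i x) - P i (T i (P i x))) with hy
    have hyD : y ∈ ⨆ o, E o := by
      refine sum_mem fun i _ => ?_
      have h1 := hTD i _ (hle _ (key i x hx).1)
      exact sub_mem h1 (hle _ (key i _ h1).1)
    have h1 : ⟪y, y⟫_ℂ = ⟪∑ i ∈ s, T i (y - P i y), x⟫_ℂ := by
      rw [show ⟪y, y⟫_ℂ = ⟪y, ∑ i ∈ s, (T i (P i x) - P i (T i (P i x)))⟫_ℂ from by rw [← hy],
        inner_sum, sum_inner]
      refine Finset.sum_congr rfl fun i _ => ?_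
      rw [inner_sub_right, ← hP_symm, ← inner_sub_left, ← hT, ← hP_symm,
        hP_mem i _ (key i y hyD).2.1]
    have h2 : ‖y‖ ^ 2 ≤ B * ‖y‖ * ‖x‖ := by
      have h3 := congrArg norm h1
      rw [inner_self_eq_norm_sq_to_K, norm_pow] at h3
      simp only [Complex.coe_algebraMap, Complex.norm_real, norm_norm] at h3
      rw [h3]
      refine (norm_inner_le_norm _ _).trans ?_
      have := hb y hyD
      gcongr
    rcases (norm_nonneg y).eq_or_lt with h | h
    · rw [← h]; positivity
    · nlinarith
  refine ⟨sum_mem fun i _ => hTD i x hx, ?_⟩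
  have hsplit : ∑ i ∈ s, T i x = ∑ i ∈ s, P i (T i (P i x)) + ∑ i ∈ s, T i (x - P i x)
      + ∑ i ∈ s, (T i (P i x) - P i (T i (P i x))) := by
    rw [← Finset.sum_add_distrib, ← Finset.sum_add_distrib]
    refine Finset.sum_congr rfl fun i _ => ?_
    rw [map_sub]; abel
  rw [hsplit]
  calc _ ≤ M * ‖x‖ + B * ‖x‖ + B * ‖x‖ :=
        norm_add_le_of_le (norm_add_le_of_le ha (hb x hx)) hcc
    _ = _ := by ring

section Words

variable {A : Type*} [Ring A] [Algebra ℂ A] {I : Type*}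

/-- A list of labelled elements is a reduced word when consecutive labels differ and every letter
is a centred element of the subalgebra of its label. -/
def IsReducedWord (φ : A →ₗ[ℂ] ℂ) (S : I → Subalgebra ℂ A) (l : List (I × A)) : Prop :=
  l.IsChain (fun p q => p.1 ≠ q.1) ∧ ∀ p ∈ l, p.2 ∈ S p.1 ∧ φ p.2 = 0

/-- The span of the products of the reduced words with first label `o` (`none` for the empty
word). -/
def wordSpan (φ : A →ₗ[ℂ] ℂ) (S : I → Subalgebra ℂ A) (o : Option I) : Submodule ℂ A :=
  Submodule.span ℂ
    {a | ∃ l, IsReducedWord φ S l ∧ l.head?.map Prod.fst = o ∧ (l.map Prod.snd).prod = a}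

variable {φ : A →ₗ[ℂ] ℂ} {S : I → Subalgebra ℂ A}

theorem IsFreeFamily.apply_prod_eq_zero (h : IsFreeFamily φ S) {l : List (I × A)}
    (hl : IsReducedWord φ S l) (hne : l ≠ []) : φ (l.map Prod.snd).prod = 0 := by
  obtain ⟨p, l', rfl⟩ := List.exists_cons_of_ne_nil hne
  have := h l'.length (fun j => ((p :: l').get j).1)
    (fun j => (List.isChain_iff_getElem.1 hl.1) j (by simp))
    (fun j => ((p :: l').get j).2) (fun j => (hl.2 _ (List.get_mem (p :: l') j)).1)
    (fun j => (hl.2 _ (List.get_mem (p :: l') j)).2)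
  convert this
  refine List.ext_getElem (by simp) fun i h1 h2 => ?_
  simp

theorem IsReducedWord.prod_mem_wordSpan {l : List (I × A)} (hl : IsReducedWord φ S l) :
    (l.map Prod.snd).prod ∈ wordSpan φ S (l.head?.map Prod.fst) :=
  Submodule.subset_span ⟨l, hl, rfl, rfl⟩

theorem one_mem_wordSpan : (1 : A) ∈ wordSpan φ S none :=
  Submodule.subset_span ⟨[], ⟨by simp, by simp⟩, rfl, rfl⟩

theorem IsReducedWord.cons {l : List (I × A)} (hl : IsReducedWord φ S l) {i : I}
    (hi : l.head?.map Prod.fst ≠ some i) {a : A} (ha : a ∈ S i) (ha0 : φ a = 0) :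
    IsReducedWord φ S ((i, a) :: l) := by
  refine ⟨List.isChain_cons.2 ⟨fun q hq h => hi ?_, hl.1⟩, ?_⟩
  · rw [Option.mem_def.1 hq]; exact congrArg some h.symm
  · simp only [List.mem_cons, forall_eq_or_imp]
    exact ⟨⟨ha, ha0⟩, hl.2⟩

/-- Left multiplication by a centred element of `S i` sends words not starting with `i` to words
starting with `i`. -/
theorem mul_mem_wordSpan {i : I} {a : A} (ha : a ∈ S i) (ha0 : φ a = 0) {o : Option I}
    (ho : o ≠ some i) {x : A} (hx : x ∈ wordSpan φ S o) : a * x ∈ wordSpan φ S (some i) := by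
  induction hx using Submodule.span_induction with
  | mem x hx =>
    obtain ⟨l, hl, rfl, rfl⟩ := hx
    simpa using (hl.cons ho ha ha0).prod_mem_wordSpan
  | zero => simp
  | add x y _ _ hx hy => rw [mul_add]; exact add_mem hx hy
  | smul c x _ hx => rw [mul_smul_comm]; exact Submodule.smul_mem _ _ hx

theorem mul_mem_iSup_wordSpan (h1 : φ 1 = 1) {i : I} {a : A} (ha : a ∈ S i) {x : A}
    (hx : x ∈ wordSpan φ S (some i)) : a * x ∈ ⨆ o, wordSpan φ S o := by
  induction hx using Submodule.span_induction with
  | mem x hx =>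
    obtain ⟨l, hl, ho, rfl⟩ := hx
    match l, hl, ho with
    | ⟨j, b⟩ :: l, hl, ho =>
      obtain rfl : j = i := by simpa using ho
      obtain ⟨hb, hb0⟩ := hl.2 (j, b) (by simp)
      have hl' : IsReducedWord φ S l := ⟨hl.1.tail, fun p hp => hl.2 p (by simp [hp])⟩
      have hhead : l.head?.map Prod.fst ≠ some j := by
        intro hj
        obtain ⟨q, hq, hqj⟩ := Option.map_eq_some_iff.1 hj
        exact (List.isChain_cons.1 hl.1).1 q hq hqj.symm
      have hab : a * b - algebraMap ℂ A (φ (a * b)) ∈ S j :=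
        sub_mem (mul_mem ha hb) (Subalgebra.algebraMap_mem _ _)
      have hab0 : φ (a * b - algebraMap ℂ A (φ (a * b))) = 0 := by
        rw [map_sub, Algebra.algebraMap_eq_smul_one, map_smul, h1]; simp
      have e : a * (((j, b) :: l).map Prod.snd).prod =
          (a * b - algebraMap ℂ A (φ (a * b))) * (l.map Prod.snd).prod +
            φ (a * b) • (l.map Prod.snd).prod := by
        rw [sub_mul, ← Algebra.smul_def]; simp [mul_assoc]
      rw [e]
      exact add_mem (le_iSup (wordSpan φ S) _ (mul_mem_wordSpan hab hab0 hhead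
        hl'.prod_mem_wordSpan)) (Submodule.smul_mem _ _ (le_iSup (wordSpan φ S) _
        hl'.prod_mem_wordSpan))
  | zero => simp
  | add x y _ _ hx hy => rw [mul_add]; exact add_mem hx hy
  | smul c x _ hx => rw [mul_smul_comm]; exact Submodule.smul_mem _ _ hx

theorem AreFree.apply_sum_sq {X : ℕ → A} {σ : ℕ → ℝ} (hfree : AreFree φ X)
    (hmean : ∀ i, φ (X i) = 0)
    (hvar : ∀ i, φ (X i ^ 2) = ((σ i ^ 2 : ℝ) : ℂ)) (s : Finset ℕ) :
    φ ((∑ i ∈ s, X i) ^ 2) = ((∑ i ∈ s, σ i ^ 2 : ℝ) : ℂ) := by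
  rw [sq, Finset.sum_mul_sum, map_sum, Complex.ofReal_sum]
  refine Finset.sum_congr rfl fun i hi => ?_
  rw [map_sum, Finset.sum_eq_single_of_mem i hi, ← sq, hvar]
  intro j _ hji
  have := IsFreeFamily.apply_prod_eq_zero hfree (l := [(i, X i), (j, X j)])
    ⟨by simpa using hji.symm, by
      simp [hmean, Algebra.self_mem_adjoin_singleton]⟩ (by simp)
  simpa using this

end Words

section Star

variable {A : Type*} [Ring A] [StarRing A] [Algebra ℂ A] [StarModule ℂ A] {I : Type*}
  {φ : A →ₗ[ℂ] ℂ} {S : I → Subalgebra ℂ A}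

/-- Reduced words with different first labels are orthogonal. -/
theorem IsFreeFamily.apply_star_mul_eq_zero (h : IsFreeFamily φ S)
    (hφ : ∀ a, φ (star a) = star (φ a)) (hS : ∀ i, ∀ a ∈ S i, star a ∈ S i) {o o' : Option I}
    (ho : o ≠ o') {x y : A} (hx : x ∈ wordSpan φ S o) (hy : y ∈ wordSpan φ S o') :
    φ (star x * y) = 0 := by
  induction hx using Submodule.span_induction with
  | zero => simp
  | add x x' _ _ hx hx' => rw [star_add, add_mul, map_add, hx, hx', add_zero]
  | smul c x _ hx => rw [star_smul, smul_mul_assoc, map_smul, hx, smul_zero]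
  | mem x hx =>
  induction hy using Submodule.span_induction with
  | zero => simp
  | add y y' _ _ hy hy' => rw [mul_add, map_add, hy, hy', add_zero]
  | smul c y _ hy => rw [mul_smul_comm, map_smul, hy, smul_zero]
  | mem y hy =>
  obtain ⟨l, hl, rfl, rfl⟩ := hx
  obtain ⟨l', hl', rfl, rfl⟩ := hy
  set m : List (I × A) := (l.map fun p => (p.1, star p.2)).reverse with hm
  have hmp : (m.map Prod.snd).prod = star (l.map Prod.snd).prod := by
    clear_value m
    subst hm
    induction l with
    | nil => simp
    | cons p l ih =>
      have hl2 : IsReducedWord φ S l := ⟨hl.1.tail, fun p hp => hl.2 p (by simp [hp])⟩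
      simp only [List.map_cons, List.reverse_cons, List.map_append, List.prod_append,
        List.prod_cons, List.map_nil, List.prod_nil, mul_one, star_mul]
      congr 1
      clear ih ho hl hl2
      induction l with
      | nil => simp
      | cons p l ih => simp_all
  rw [← hmp, ← List.prod_append, ← List.map_append]
  refine h.apply_prod_eq_zero ⟨List.isChain_append.2 ⟨?_, hl'.1, ?_⟩, ?_⟩ ?_
  · rw [hm, List.isChain_reverse, List.isChain_map]
    exact hl.1.imp fun p q hpq => hpq.symm
  · intro p hp q hq hpq
    rw [hm, List.getLast?_reverse, List.head?_map, Option.mem_def, Option.map_eq_some_iff] at hp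
    obtain ⟨r, hr, rfl⟩ := hp
    exact ho (by rw [hr, Option.mem_def.1 hq]; simpa using hpq)
  · intro p hp
    rcases List.mem_append.1 hp with hp | hp
    · rw [hm, List.mem_reverse, List.mem_map] at hp
      obtain ⟨r, hr, rfl⟩ := hp
      exact ⟨hS _ _ (hl.2 r hr).1, by rw [hφ, (hl.2 r hr).2, star_zero]⟩
    · exact hl'.2 p hp
  · rintro hnil
    rw [List.append_eq_nil_iff, hm, List.reverse_eq_nil_iff, List.map_eq_nil_iff] at hnil
    exact ho (by rw [hnil.1, hnil.2])

theorem star_mem_adjoin_singleton {a : A} (ha : IsSelfAdjoint a) {x : A}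
    (hx : x ∈ Algebra.adjoin ℂ {a}) : star x ∈ Algebra.adjoin ℂ {a} := by
  induction hx using Algebra.adjoin_induction with
  | mem x hx =>
    rw [Set.mem_singleton_iff.1 hx, ha.star_eq]
    exact Algebra.self_mem_adjoin_singleton ℂ a
  | algebraMap r => rw [← algebraMap_star_comm]; exact Subalgebra.algebraMap_mem _ _
  | add x y _ _ hx hy => rw [star_add]; exact add_mem hx hy
  | mul x y _ _ hx hy => rw [star_mul]; exact mul_mem hy hx

end Star

theorem IsState.nontrivial {A : Type*} [Ring A] [StarRing A] [Algebra ℂ A] {φ : A →ₗ[ℂ] ℂ}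
    (hφ : IsState φ) : Nontrivial A :=
  nontrivial_of_ne 1 0 fun h => by simpa [h] using hφ.1

section CStar

open scoped ComplexOrder

variable {A : Type*} [CStarAlgebra A] [PartialOrder A] [StarOrderedRing A] {φ : A →ₗ[ℂ] ℂ}

/-- A state as a positive linear functional. -/
noncomputable def IsState.toPositiveLinearMap (hφ : IsState φ) : A →ₚ[ℂ] ℂ :=
  PositiveLinearMap.mk₀ φ fun x hx => by
    obtain ⟨y, rfl⟩ := CStarAlgebra.nonneg_iff_eq_star_mul_self.1 hx
    obtain ⟨h1, h2⟩ := hφ.2 y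
    exact Complex.nonneg_iff.2 ⟨h1, h2.symm⟩

theorem IsState.apply_star (hφ : IsState φ) (a : A) : φ (star a) = star (φ a) :=
  map_star hφ.toPositiveLinearMap a

theorem IsState.re_mono (hφ : IsState φ) {a b : A} (h : a ≤ b) : (φ a).re ≤ (φ b).re :=
  (Complex.le_def.1 (OrderHomClass.mono hφ.toPositiveLinearMap h)).1

theorem IsState.re_apply_le_norm (hφ : IsState φ) {a : A} (ha : IsSelfAdjoint a) :
    (φ a).re ≤ ‖a‖ := by
  have h := hφ.re_mono ha.le_algebraMap_norm_self
  rw [IsScalarTower.algebraMap_apply ℝ ℂ A, Algebra.algebraMap_eq_smul_one, map_smul, hφ.1] at h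
  simpa using h

/-- For a faithful state, the norm of a self-adjoint element is controlled by the growth of its
even moments. -/
theorem norm_le_of_moments_le (hφ : IsState φ) (hFa : IsFaithful φ) {a : A}
    (ha : IsSelfAdjoint a) {C : ℝ} (hC : 0 ≤ C)
    (h : ∀ k : ℕ, (φ (a ^ (2 * k))).re ≤ C ^ (2 * k)) : ‖a‖ ≤ C := by
  have := hφ.nontrivial
  refine le_of_forall_gt_imp_ge_of_dense fun D hD => ?_
  have hD0 : 0 < D := hC.trans_lt hD
  set g : ℝ → ℝ := fun t => max (|t| - D) 0 with hg
  have hgc : Continuous g := by fun_prop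
  have hb : ∀ k : ℕ, (φ (star (cfc g a) * cfc g a)).re ≤ ‖a‖ ^ 2 * ((C / D) ^ 2) ^ k := by
    intro k
    have h1 : cfc (fun t => g t * g t) a ≤
        cfc (fun t => (‖a‖ ^ 2 / D ^ (2 * k)) * t ^ (2 * k)) a := by
      refine cfc_mono (fun t ht => ?_)
      have ht' : |t| ≤ ‖a‖ := by simpa using spectrum.norm_le_norm_of_mem ht
      rcases le_total |t| D with htD | htD
      · have : g t = 0 := max_eq_right (by linarith)
        rw [this, zero_mul]
        exact mul_nonneg (by positivity) ((even_two_mul k).pow_nonneg t)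
      · have h2 : g t = |t| - D := max_eq_left (by linarith)
        have h3 : g t * g t ≤ ‖a‖ ^ 2 := by
          rw [h2, sq]
          gcongr <;> linarith
        have h4 : D ^ (2 * k) ≤ t ^ (2 * k) := by
          rw [← (even_two_mul k).pow_abs t]
          gcongr
        rw [div_mul_eq_mul_div, le_div_iff₀ (by positivity)]
        gcongr
    have h2 := hφ.re_mono h1
    rw [cfc_mul g g a, cfc_const_mul _ _ a, cfc_pow_id a, ← Complex.coe_smul, map_smul,
      smul_eq_mul, Complex.re_ofReal_mul] at h2
    rw [(cfc_predicate g a : IsSelfAdjoint (cfc g a)).star_eq]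
    calc _ ≤ ‖a‖ ^ 2 / D ^ (2 * k) * C ^ (2 * k) :=
          h2.trans (mul_le_mul_of_nonneg_left (h k) (by positivity))
      _ = _ := by rw [← pow_mul, div_pow]; ring
  have hlim : Tendsto (fun k : ℕ => ‖a‖ ^ 2 * ((C / D) ^ 2) ^ k) atTop (𝓝 (‖a‖ ^ 2 * 0)) := by
    refine (tendsto_pow_atTop_nhds_zero_of_lt_one (by positivity) ?_).const_mul _
    have : C / D < 1 := (div_lt_one hD0).2 hD
    have : 0 ≤ C / D := by positivity
    nlinarith
  rw [mul_zero] at hlim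
  obtain ⟨h0, h0'⟩ := hφ.2 (cfc g a)
  have hz : φ (star (cfc g a) * cfc g a) = 0 :=
    Complex.ext (le_antisymm (ge_of_tendsto' hlim hb) h0) h0'
  have hg0 := hFa _ hz
  have hle := (norm_cfc_le_iff g a (c := 0) le_rfl hgc.continuousOn ha).1 (by simp [hg0])
  rw [← cfc_id ℝ a]
  refine norm_cfc_le hD0.le fun t ht => ?_
  have h1 : g t = 0 := by simpa using hle t ht
  have h2 : |t| - D ≤ g t := le_max_left _ _
  simp only [id, Real.norm_eq_abs]
  linarith

/-- **Voiculescu's inequality** for sums of free centred self-adjoint elements. -/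
theorem norm_sum_le_of_isFreeFamily (hφ : IsState φ) (hFa : IsFaithful φ) {I : Type*}
    {S : I → Subalgebra ℂ A} (hS : ∀ i, ∀ a ∈ S i, star a ∈ S i) (hfree : IsFreeFamily φ S)
    {Y : I → A} (hY : ∀ i, Y i ∈ S i) (hsa : ∀ i, IsSelfAdjoint (Y i)) (hmean : ∀ i, φ (Y i) = 0)
    (s : Finset I) {M : ℝ} (hM : 0 ≤ M) (hYM : ∀ i ∈ s, ‖Y i‖ ≤ M) :
    ‖∑ i ∈ s, Y i‖ ≤ M + 2 * √(∑ i ∈ s, (φ (Y i ^ 2)).re) := by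
  set f := hφ.toPositiveLinearMap with hf
  set π := f.gnsStarAlgHom with hπ
  let ι : A →ₗ[ℂ] f.GNS :=
    (UniformSpace.Completion.toComplL (𝕜 := ℂ) (E := f.PreGNS)).toLinearMap ∘ₗ
      f.toPreGNS.toLinearMap
  have hπι : ∀ a b, π a (ι b) = ι (a * b) := by
    intro a b
    exact f.gnsNonUnitalStarAlgHom_apply_coe
  have hinner : ∀ a b, ⟪ι a, ι b⟫_ℂ = φ (star a * b) := by
    intro a b
    exact UniformSpace.Completion.inner_coe _ _
  have hYsq : ∀ i, φ (Y i ^ 2) = ((φ (Y i ^ 2)).re : ℂ) ∧ 0 ≤ (φ (Y i ^ 2)).re := by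
    intro i
    have := hφ.2 (Y i)
    rw [(hsa i).star_eq, ← sq] at this
    exact ⟨Complex.ext rfl this.2, this.1⟩
  set C := M + 2 * √(∑ i ∈ s, (φ (Y i ^ 2)).re) with hC
  have hC0 : 0 ≤ C := by positivity
  have hsum : IsSelfAdjoint (∑ i ∈ s, Y i) := isSelfAdjoint_sum _ fun i _ => hsa i
  have hmap : ∀ x ∈ ⨆ o, wordSpan φ S o, ι x ∈ ⨆ o, (wordSpan φ S o).map ι := by
    intro x hx
    rw [← Submodule.map_iSup]
    exact Submodule.mem_map_of_mem hx
  have main := norm_sum_apply_le_of_pairwise_isOrtho s (fun o => (wordSpan φ S o).map ι)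
    (by
      intro o o' ho
      rw [Submodule.isOrtho_iff_inner_eq]
      rintro _ ⟨x, hx, rfl⟩ _ ⟨y, hy, rfl⟩
      rw [hinner]
      exact hfree.apply_star_mul_eq_zero hφ.apply_star hS ho hx hy)
    (fun i => π (Y i))
    (by
      intro i x y
      have : ContinuousLinearMap.adjoint (π (Y i)) = π (Y i) := by
        rw [← ContinuousLinearMap.star_eq_adjoint, ← map_star, (hsa i).star_eq]
      conv_lhs => rw [← this]
      exact ContinuousLinearMap.adjoint_inner_left _ _ _)
    (by
      rintro i o ho _ ⟨x, hx, rfl⟩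
      rw [hπι]
      exact Submodule.mem_map_of_mem (mul_mem_wordSpan (hY i) (hmean i) ho hx))
    (by
      rintro i _ ⟨x, hx, rfl⟩
      rw [hπι]
      exact hmap _ (mul_mem_iSup_wordSpan hφ.1 (hY i) hx))
    (fun i => (φ (Y i ^ 2)).re) (fun i => (hYsq i).2)
    (by
      rintro i o ho _ ⟨x, hx, rfl⟩
      have e : Y i * (Y i * x) - (((φ (Y i ^ 2)).re : ℝ) : ℂ) • x
          = (Y i ^ 2 - algebraMap ℂ A (φ (Y i ^ 2))) * x := by
        rw [← (hYsq i).1, sub_mul, ← Algebra.smul_def, sq, mul_assoc]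
      rw [hπι, hπι, ← map_smul, ← map_sub, e]
      refine Submodule.mem_map_of_mem (mul_mem_wordSpan ?_ ?_ ho hx)
      · exact sub_mem (pow_mem (hY i) 2) (Subalgebra.algebraMap_mem _ _)
      · rw [map_sub, Algebra.algebraMap_eq_smul_one, map_smul, hφ.1]; simp)
    M hM (fun i hi => (NonUnitalStarAlgHom.norm_apply_le π (Y i)).trans (hYM i hi))
  refine norm_le_of_moments_le hφ hFa hsum hC0 fun k => ?_
  have hk : ∀ k : ℕ, ι ((∑ i ∈ s, Y i) ^ k) ∈ (⨆ o, (wordSpan φ S o).map ι) ∧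
      ‖ι ((∑ i ∈ s, Y i) ^ k)‖ ≤ C ^ k := by
    intro k
    induction k with
    | zero =>
      rw [pow_zero, pow_zero]
      refine ⟨hmap _ (le_iSup (wordSpan φ S) none one_mem_wordSpan), ?_⟩
      have := inner_self_eq_norm_sq (𝕜 := ℂ) (ι 1)
      rw [hinner, star_one, one_mul, hφ.1] at this
      have h1 : ‖ι 1‖ ^ 2 = 1 := by rw [← this]; simp
      nlinarith [norm_nonneg (ι 1)]
    | succ k ih =>
      have := main _ ih.1
      simp only [hπι] at this
      rw [← map_sum, ← Finset.sum_mul, ← pow_succ'] at this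
      refine ⟨this.1, this.2.trans ?_⟩
      rw [pow_succ' C]
      exact mul_le_mul_of_nonneg_left ih.2 hC0
  have h1 := inner_self_eq_norm_sq (𝕜 := ℂ) (ι ((∑ i ∈ s, Y i) ^ k))
  rw [hinner, (hsum.pow k).star_eq, ← pow_add, ← two_mul] at h1
  calc _ = ‖ι ((∑ i ∈ s, Y i) ^ k)‖ ^ 2 := h1
    _ ≤ (C ^ k) ^ 2 := by
      have := (hk k).2
      gcongr
    _ = C ^ (2 * k) := by rw [← pow_mul, mul_comm]

theorem IsState.sq_le_norm_sq (hφ : IsState φ) {a : A} (ha : IsSelfAdjoint a) {r : ℝ}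
    (hr : φ (a ^ 2) = (r : ℂ)) : r ≤ ‖a‖ ^ 2 := by
  have h := hφ.re_apply_le_norm (ha.pow 2)
  rw [hr, Complex.ofReal_re] at h
  exact h.trans (norm_pow_le' a two_pos)

end CStar

theorem integrable_pow_of_isDistribution {A : Type*} [CStarAlgebra A] {φ : A →ₗ[ℂ] ℂ}
    (hFa : IsFaithful φ) {a : A}
    (ha : IsSelfAdjoint a) (ha0 : a ≠ 0) {μ : Measure ℝ} (hμ : IsDistribution φ a μ) (k : ℕ) :
    Integrable (fun t : ℝ => t ^ (2 * k)) μ := by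
  by_contra hk
  have h := hμ.2 (2 * k)
  rw [integral_undef hk, Complex.ofReal_zero] at h
  have h1 : a ^ k = 0 := by
    refine hFa _ ?_
    rwa [(ha.pow k).star_eq, ← pow_add, ← two_mul]
  have h2 : a ^ 2 ^ k = 0 := pow_eq_zero_of_le Nat.lt_two_pow_self.le h1
  have h3 := ha.norm_pow_two_pow k
  rw [h2, norm_zero] at h3
  exact ha0 (norm_eq_zero.1 (eq_zero_of_pow_eq_zero h3.symm))

theorem abs_le_of_mem_msupport {μ : Measure ℝ} [IsProbabilityMeasure μ] {R : ℝ} (hR : 0 ≤ R)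
    (hint : ∀ k : ℕ, Integrable (fun t : ℝ => t ^ (2 * k)) μ)
    (h : ∀ k : ℕ, ∫ t, t ^ (2 * k) ∂μ ≤ R ^ (2 * k)) {x : ℝ} (hx : x ∈ msupport μ) :
    |x| ≤ R := by
  by_contra! hRx
  obtain ⟨D, hRD, hDx⟩ := exists_between hRx
  have hD0 : 0 < D := hR.trans_lt hRD
  have hpos : 0 < μ.real {t : ℝ | D < |t|} :=
    ENNReal.toReal_pos (hx _ (isOpen_lt continuous_const continuous_abs) hDx).ne'
      (measure_ne_top _ _)
  have hb : ∀ k : ℕ, μ.real {t : ℝ | D < |t|} ≤ ((R / D) ^ 2) ^ k := by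
    intro k
    have h1 := mul_meas_ge_le_integral_of_nonneg
      (ae_of_all μ fun t : ℝ => (even_two_mul k).pow_nonneg t) (hint k) (D ^ (2 * k))
    have h2 : μ.real {t : ℝ | D < |t|} ≤ μ.real {t : ℝ | D ^ (2 * k) ≤ t ^ (2 * k)} := by
      refine measureReal_mono fun t ht => ?_
      have ht' : D < |t| := ht
      change D ^ (2 * k) ≤ t ^ (2 * k)
      rw [← (even_two_mul k).pow_abs t]
      gcongr
    rw [← pow_mul, div_pow, le_div_iff₀ (by positivity), mul_comm]
    exact (mul_le_mul_of_nonneg_left h2 (by positivity)).trans (h1.trans (h k))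
  have hlim : Tendsto (fun k : ℕ => ((R / D) ^ 2) ^ k) atTop (𝓝 0) := by
    refine tendsto_pow_atTop_nhds_zero_of_lt_one (by positivity) ?_
    have h1 : R / D < 1 := (div_lt_one hD0).2 hRD
    have h2 : 0 ≤ R / D := by positivity
    nlinarith
  exact hpos.not_ge (ge_of_tendsto' hlim hb)

theorem norm_le_biSup_range {A : Type*} [NormedAddCommGroup A] (X : ℕ → A) {n i : ℕ}
    (hi : i ∈ Finset.range n) :
    ‖X i‖ ≤ ⨆ i ∈ Finset.range n, ‖X i‖ := by
  have hbdd : BddAbove (Set.range fun i => ⨆ _ : i ∈ Finset.range n, ‖X i‖) := by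
    refine ⟨∑ j ∈ Finset.range n, ‖X j‖, ?_⟩
    rintro _ ⟨j, rfl⟩
    refine Real.iSup_le (fun hj => ?_) (by positivity)
    exact Finset.single_le_sum (f := fun j => ‖X j‖) (fun j _ => norm_nonneg _) hj
  refine le_trans ?_ (le_ciSup hbdd i)
  rw [ciSup_pos hi]

section Free

variable {A : Type*} [CStarAlgebra A] [PartialOrder A] [StarOrderedRing A] {φ : A →ₗ[ℂ] ℂ}
  {X : ℕ → A} {σ : ℕ → ℝ}

theorem norm_sum_le_of_areFree (hφ : IsState φ) (hFa : IsFaithful φ)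
    (hsa : ∀ i, IsSelfAdjoint (X i)) (hfree : AreFree φ X) (hmean : ∀ i, φ (X i) = 0)
    (hvar : ∀ i, φ (X i ^ 2) = ((σ i ^ 2 : ℝ) : ℂ)) (s : Finset ℕ) {M : ℝ} (hM : 0 ≤ M)
    (hXM : ∀ i ∈ s, ‖X i‖ ≤ M) :
    ‖∑ i ∈ s, X i‖ ≤ M + 2 * √(∑ i ∈ s, σ i ^ 2) := by
  have := norm_sum_le_of_isFreeFamily hφ hFa (fun i a => star_mem_adjoin_singleton (hsa i))
    hfree (fun i => Algebra.self_mem_adjoin_singleton ℂ (X i)) hsa hmean s hM hXM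
  simpa only [hvar, Complex.ofReal_re] using this

theorem norm_sum_sq_sub_le_of_areFree (hφ : IsState φ) (hFa : IsFaithful φ)
    (hsa : ∀ i, IsSelfAdjoint (X i)) (hfree : AreFree φ X)
    (hvar : ∀ i, φ (X i ^ 2) = ((σ i ^ 2 : ℝ) : ℂ)) (s : Finset ℕ) {q : ℝ} (hq : 0 ≤ q)
    (hXq : ∑ i ∈ s, ‖X i‖ ^ 4 ≤ q ^ 2) :
    ‖∑ i ∈ s, X i ^ 2 - ((∑ i ∈ s, σ i ^ 2 : ℝ) : ℂ) • (1 : A)‖ ≤ 4 * q := by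
  have := hφ.nontrivial
  set Y : ℕ → A := fun i => X i ^ 2 - algebraMap ℂ A ((σ i ^ 2 : ℝ) : ℂ) with hY
  have hsaY : ∀ i, IsSelfAdjoint (Y i) := fun i =>
    ((hsa i).pow 2).sub (.algebraMap A (Complex.conj_ofReal _))
  have hmeanY : ∀ i, φ (Y i) = 0 := fun i => by
    simp only [hY]
    rw [map_sub, hvar, Algebra.algebraMap_eq_smul_one, map_smul, hφ.1]; simp
  have hYsq : ∀ i, (φ (Y i ^ 2)).re ≤ ‖X i‖ ^ 4 := by
    intro i
    have e : Y i ^ 2 = X i ^ 4 - (2 * ((σ i ^ 2 : ℝ) : ℂ)) • X i ^ 2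
        + (((σ i ^ 2 : ℝ) : ℂ) ^ 2) • (1 : A) := by
      simp only [hY, Algebra.algebraMap_eq_smul_one, sq (_ - _), mul_sub, sub_mul, smul_mul_assoc,
        mul_smul_comm, one_mul, mul_one, ← pow_add]
      module
    have h1 : φ (Y i ^ 2) = φ (X i ^ 4) - (((σ i ^ 2) ^ 2 : ℝ) : ℂ) := by
      rw [e, map_add, map_sub, map_smul, map_smul, hvar, hφ.1]
      simp only [smul_eq_mul]
      push_cast
      ring
    rw [h1, Complex.sub_re, Complex.ofReal_re]
    have h2 := hφ.re_apply_le_norm ((hsa i).pow 4)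
    have h3 := norm_pow_le' (X i) (n := 4) (by norm_num)
    nlinarith [sq_nonneg (σ i ^ 2)]
  have hYnorm : ∀ i ∈ s, ‖Y i‖ ≤ 2 * q := by
    intro i hi
    have h1 : ‖X i‖ ^ 2 ≤ q := by
      refine (sq_le_sq₀ (by positivity) hq).1 (le_trans ?_ hXq)
      rw [← pow_mul]
      exact Finset.single_le_sum (f := fun i => ‖X i‖ ^ 4) (fun i _ => by positivity) hi
    have h2 := hφ.sq_le_norm_sq (hsa i) (hvar i)
    calc ‖Y i‖ ≤ ‖X i ^ 2‖ + ‖algebraMap ℂ A ((σ i ^ 2 : ℝ) : ℂ)‖ := norm_sub_le _ _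
      _ ≤ ‖X i‖ ^ 2 + σ i ^ 2 := by
        rw [norm_algebraMap', Complex.norm_real, Real.norm_of_nonneg (sq_nonneg _)]
        gcongr
        exact norm_pow_le' _ two_pos
      _ ≤ 2 * q := by linarith
  have h := norm_sum_le_of_isFreeFamily hφ hFa (Y := Y)
    (fun i a => star_mem_adjoin_singleton (hsa i)) hfree
    (fun i => sub_mem (pow_mem (Algebra.self_mem_adjoin_singleton ℂ (X i)) 2)
      (Subalgebra.algebraMap_mem _ _)) hsaY hmeanY s (by positivity : 0 ≤ 2 * q) hYnorm
  have hsqrt : √(∑ i ∈ s, (φ (Y i ^ 2)).re) ≤ q :=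
    Real.sqrt_le_iff.2 ⟨hq, (Finset.sum_le_sum fun i _ => hYsq i).trans hXq⟩
  have e : ∑ i ∈ s, Y i = ∑ i ∈ s, X i ^ 2 - ((∑ i ∈ s, σ i ^ 2 : ℝ) : ℂ) • (1 : A) := by
    rw [← Algebra.algebraMap_eq_smul_one, Complex.ofReal_sum, map_sum, ← Finset.sum_sub_distrib]
  rw [← e]
  linarith

/-- The norm of the self-normalized sum. -/
theorem norm_selfNormalized_lt (hφ : IsState φ) (hFa : IsFaithful φ) (n : ℕ)
    (hsa : ∀ i, IsSelfAdjoint (X i)) (hfree : AreFree φ X) (hmean : ∀ i, φ (X i) = 0)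
    (hvar : ∀ i, φ (X i ^ 2) = ((σ i ^ 2 : ℝ) : ℂ)) (hB : 0 < ∑ i ∈ Finset.range n, σ i ^ 2)
    (hL4 : Lsn X σ 4 n < 1 / 64) {W : A} (hW : IsSelfAdjoint W)
    (hWl : W ^ 4 * (∑ i ∈ Finset.range n, X i ^ 2) = 1) :
    ‖W * (∑ i ∈ Finset.range n, X i) * W‖ <
      2 + (⨆ i ∈ Finset.range n, ‖X i‖) / √(∑ i ∈ Finset.range n, σ i ^ 2)
          + 57 * √(Lsn X σ 4 n) := by
  have := hφ.nontrivial
  set L := Lsn X σ 4 n with hL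
  set b := ∑ i ∈ Finset.range n, σ i ^ 2 with hb
  set M := ⨆ i ∈ Finset.range n, ‖X i‖ with hM
  set q := √L with hq
  have hB0 : 0 < √b := Real.sqrt_pos.2 hB
  have hBsq : √b ^ 2 = b := Real.sq_sqrt hB.le
  have hB4 : √b ^ 4 = b ^ 2 := by rw [show 4 = 2 * 2 from rfl, pow_mul, hBsq]
  have hsum4 : ∑ i ∈ Finset.range n, ‖X i‖ ^ 4 = L * b ^ 2 := by
    rw [hL, Lsn, ← hb, hB4]
    field_simp
  have hL0 : 0 < L := by
    by_contra! h
    have h0 : ∑ i ∈ Finset.range n, ‖X i‖ ^ 4 = 0 :=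
      le_antisymm (hsum4 ▸ mul_nonpos_of_nonpos_of_nonneg h (sq_nonneg _))
        (Finset.sum_nonneg fun i _ => by positivity)
    refine hB.ne' (Finset.sum_eq_zero fun i hi => ?_)
    have h1 := (Finset.sum_eq_zero_iff_of_nonneg fun i _ => by positivity).1 h0 i hi
    have h2 : ‖X i‖ = 0 := eq_zero_of_pow_eq_zero h1
    have h3 := hφ.sq_le_norm_sq (hsa i) (hvar i)
    rw [h2] at h3
    exact le_antisymm (by simpa using h3) (sq_nonneg _)
  have hq0 : 0 < q := Real.sqrt_pos.2 hL0
  have hqL : q ^ 2 = L := Real.sq_sqrt hL0.le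
  have hq8 : q < 1 / 8 := by nlinarith
  have hXM : ∀ i ∈ Finset.range n, ‖X i‖ ≤ M := fun i hi => norm_le_biSup_range X hi
  have hM0 : 0 ≤ M := Real.iSup_nonneg fun i => Real.iSup_nonneg fun _ => norm_nonneg _
  have hMB : M ≤ √b / 2 := by
    refine Real.iSup_le (fun i => Real.iSup_le (fun hi => ?_) (by positivity)) (by positivity)
    have h1 : ‖X i‖ ^ 4 ≤ L * b ^ 2 := by
      rw [← hsum4]
      exact Finset.single_le_sum (f := fun i => ‖X i‖ ^ 4) (fun i _ => by positivity) hi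
    refine le_of_pow_le_pow_left₀ (n := 4) (by norm_num) (by positivity) (h1.trans ?_)
    rw [div_pow, hB4]
    nlinarith [sq_nonneg b]
  have hS : ‖∑ i ∈ Finset.range n, X i‖ ≤ M + 2 * √b :=
    norm_sum_le_of_areFree hφ hFa hsa hfree hmean hvar _ hM0 hXM
  have hV := norm_sum_sq_sub_le_of_areFree hφ hFa hsa hfree hvar (Finset.range n)
    (q := q * b) (by positivity) (by rw [hsum4, mul_pow, hqL])
  rw [← hb] at hV
  set V := ∑ i ∈ Finset.range n, X i ^ 2 with hVdef
  have hW4 : ‖W ^ 4‖ = ‖W‖ ^ 4 := hW.norm_pow_two_pow 2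
  have hWb : ‖W‖ ^ 4 * b ≤ 1 + ‖W‖ ^ 4 * (4 * (q * b)) := by
    have e : (b : ℂ) • W ^ 4 = 1 - W ^ 4 * (V - (b : ℂ) • (1 : A)) := by
      rw [mul_sub, hWl, mul_smul_comm, mul_one, sub_sub_cancel]
    calc ‖W‖ ^ 4 * b = ‖(b : ℂ) • W ^ 4‖ := by
          rw [norm_smul, hW4, Complex.norm_real, Real.norm_of_nonneg hB.le, mul_comm]
      _ ≤ ‖(1 : A)‖ + ‖W ^ 4 * (V - (b : ℂ) • (1 : A))‖ := by rw [e]; exact norm_sub_le _ _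
      _ ≤ 1 + ‖W‖ ^ 4 * (4 * (q * b)) := by
          rw [CStarRing.norm_one, ← hW4]
          gcongr
          exact (norm_mul_le _ _).trans (by gcongr)
  set a := ‖W‖ ^ 2 * √b with ha
  have ha0 : 0 ≤ a := by positivity
  have ha2 : a ^ 2 * (1 - 4 * q) ≤ 1 := by
    rw [ha, mul_pow, hBsq]
    nlinarith
  have ha1 : a ≤ 1 + 4 * q := by
    refine (sq_le_sq₀ ha0 (by positivity)).1 ?_
    have h1 : 0 < 1 - 4 * q := by linarith
    refine le_of_mul_le_mul_right (ha2.trans ?_) h1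
    nlinarith [mul_pos hq0 hq0]
  have hr0 : 0 ≤ M / √b := by positivity
  have hr : M / √b ≤ 1 / 2 := by
    rw [div_le_iff₀ hB0]; linarith
  calc ‖W * (∑ i ∈ Finset.range n, X i) * W‖ ≤ ‖W‖ * (M + 2 * √b) * ‖W‖ := by
        refine (norm_mul_le _ _).trans ?_
        gcongr
        exact (norm_mul_le _ _).trans (by gcongr)
    _ = a * (2 + M / √b) := by rw [ha]; field_simp; ring
    _ ≤ (1 + 4 * q) * (2 + M / √b) := by gcongr
    _ < 2 + M / √b + 57 * q := by nlinarith

theorem msupport_selfNormalized_subset (hφ : IsState φ) (hFa : IsFaithful φ) (n : ℕ)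
    (hsa : ∀ i, IsSelfAdjoint (X i)) (hfree : AreFree φ X) (hmean : ∀ i, φ (X i) = 0)
    (hvar : ∀ i, φ (X i ^ 2) = ((σ i ^ 2 : ℝ) : ℂ)) (hB : 0 < ∑ i ∈ Finset.range n, σ i ^ 2)
    (hL4 : Lsn X σ 4 n < 1 / 64) {W : A} (hW : 0 ≤ W)
    (hWl : W ^ 4 * (∑ i ∈ Finset.range n, X i ^ 2) = 1)
    (hWr : (∑ i ∈ Finset.range n, X i ^ 2) * W ^ 4 = 1) {μ : Measure ℝ}
    (hμ : IsDistribution φ (W * (∑ i ∈ Finset.range n, X i) * W) μ) :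
    msupport μ ⊆
      Set.Ioo
        (-2 - (⨆ i ∈ Finset.range n, ‖X i‖) / √(∑ i ∈ Finset.range n, σ i ^ 2)
          - 57 * √(Lsn X σ 4 n))
        (2 + (⨆ i ∈ Finset.range n, ‖X i‖) / √(∑ i ∈ Finset.range n, σ i ^ 2)
          + 57 * √(Lsn X σ 4 n)) := by
  have hWsa : IsSelfAdjoint W := .of_nonneg hW
  have hlt := norm_selfNormalized_lt hφ hFa n hsa hfree hmean hvar hB hL4 hWsa hWl
  set S := ∑ i ∈ Finset.range n, X i with hS
  set V := ∑ i ∈ Finset.range n, X i ^ 2 with hV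
  set U := W * S * W with hU
  have hSsa : IsSelfAdjoint S := isSelfAdjoint_sum _ fun i _ => hsa i
  have hUsa : IsSelfAdjoint U := by
    have := hSsa.conjugate W
    rwa [hWsa.star_eq] at this
  have hU0 : U ≠ 0 := by
    intro h
    have hS0 : S = 0 := by
      calc S = (V * W ^ 4) * S * (W ^ 4 * V) := by rw [hWl, hWr, one_mul, mul_one]
        _ = V * W ^ 3 * U * (W ^ 3 * V) := by rw [hU]; noncomm_ring
        _ = 0 := by rw [h, mul_zero, zero_mul]
    have h1 := hfree.apply_sum_sq hmean hvar (Finset.range n)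
    rw [← hS, hS0, sq, mul_zero, map_zero] at h1
    exact hB.ne' (Complex.ofReal_eq_zero.1 h1.symm)
  have := hμ.1
  intro x hx
  have hxU : |x| ≤ ‖U‖ := by
    refine abs_le_of_mem_msupport (norm_nonneg _)
      (integrable_pow_of_isDistribution hFa hUsa hU0 hμ) (fun k => ?_) hx
    have h1 := hφ.re_apply_le_norm (hUsa.pow (2 * k))
    rw [hμ.2, Complex.ofReal_re] at h1
    have := hφ.nontrivial
    exact h1.trans (norm_pow_le U _)
  have h2 := abs_lt.1 (hxU.trans_lt hlt)
  exact ⟨by linarith [h2.1], h2.2⟩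

end Free

/-- **Corollary 1.2** (superconvergence): under `L_{S,4n} < 1/64`, the support of the analytic
distribution `μ_n` of the self-normalized sum `U_n = V_n^{-1/2} S_n V_n^{-1/2}`
(written `W * S_n * W` with `W ≥ 0` the inverse fourth root of `V_n²`) is contained in
`(-2 - max_i ‖X_i‖/B_n - 57·L_{S,4n}^{1/2}, 2 + max_i ‖X_i‖/B_n + 57·L_{S,4n}^{1/2})`. -/
theorem stmt_2 (A : Type*) [NormedRing A] [StarRing A] [CStarRing A] [NormedAlgebra ℂ A]
    [CompleteSpace A] [StarModule ℂ A] [PartialOrder A] [StarOrderedRing A]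
    (φ : A →ₗ[ℂ] ℂ) (hφ : IsState φ) (hTr : IsTracial φ) (hFa : IsFaithful φ)
    (X : ℕ → A) (σ : ℕ → ℝ) (n : ℕ)
    (hsa : ∀ i, IsSelfAdjoint (X i)) (hfree : AreFree φ X)
    (hmean : ∀ i, φ (X i) = 0) (hvar : ∀ i, φ (X i ^ 2) = ((σ i ^ 2 : ℝ) : ℂ))
    (hB : 0 < ∑ i ∈ Finset.range n, σ i ^ 2)
    (hL4 : Lsn X σ 4 n < 1 / 64)
    (W : A) (hW : 0 ≤ W)
    (hWl : W ^ 4 * (∑ i ∈ Finset.range n, X i ^ 2) = 1)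
    (hWr : (∑ i ∈ Finset.range n, X i ^ 2) * W ^ 4 = 1)
    (μ : Measure ℝ)
    (hμ : IsDistribution φ (W * (∑ i ∈ Finset.range n, X i) * W) μ) :
    msupport μ ⊆
      Set.Ioo
        (-2 - (⨆ i ∈ Finset.range n, ‖X i‖) / Real.sqrt (∑ i ∈ Finset.range n, σ i ^ 2)
          - 57 * Real.sqrt (Lsn X σ 4 n))
        (2 + (⨆ i ∈ Finset.range n, ‖X i‖) / Real.sqrt (∑ i ∈ Finset.range n, σ i ^ 2)
          + 57 * Real.sqrt (Lsn X σ 4 n)) := by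
  let : CStarAlgebra A := {}
  exact msupport_selfNormalized_subset hφ hFa n hsa hfree hmean hvar hB hL4 hW hWl hWr hμ
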